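/- arXiv:2209.07557 — 2 statements merged into one kernel-verified Lean document; each statement's English description precedes it below -/
import Mathlib

section
/- Let S = (W_1,...,W_k) be a minimum-length covering strategy for a tree T, and let P(W_i) and F(W_i) be the path and forest of once- and twice-traversed edges of W_i respectively. Then every connected component C of every forest F(W_i) intersects the union of the vertex sets of the paths P(W_1),...,P(W_k) in exactly one vertex. -/
open Finset

variable {V : Type*}

/-- The list of consecutive steps of a walk given as a list of vertices. -/
def wsteps (W : List V) : List (V × V) := W.zip W.tail

/-- A walk on a graph: a nonempty list of vertices in which consecutive
entries are equal or adjacent. -/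
def IsWalk (G : SimpleGraph V) (W : List V) : Prop :=
  W ≠ [] ∧ ∀ p ∈ wsteps W, p.1 = p.2 ∨ G.Adj p.1 p.2

/-- The length of a walk: the number of position-changing moves. -/
def wlen [DecidableEq V] (W : List V) : ℕ :=
  (wsteps W).countP (fun p => decide (p.1 ≠ p.2))

/-- The number of times a walk traverses the edge `{x, y}` (in either direction). -/
def trav [DecidableEq V] (W : List V) (x y : V) : ℕ :=
  (wsteps W).countP (fun p => decide ((p.1 = x ∧ p.2 = y) ∨ (p.1 = y ∧ p.2 = x)))

/-- The number of times a walk traverses the edge `(x, y)` from `x` to `y`. -/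
def dirTrav [DecidableEq V] (W : List V) (x y : V) : ℕ :=
  (wsteps W).countP (fun p => decide (p.1 = x ∧ p.2 = y))

/-- A tuple of walks covers the graph: every vertex appears in some walk. -/
def Covers {k : ℕ} (S : Fin k → List V) : Prop := ∀ v : V, ∃ i, v ∈ S i

/-- The total length of a strategy: the sum of the lengths of the walks. -/
def slen [DecidableEq V] {k : ℕ} (S : Fin k → List V) : ℕ := ∑ i, wlen (S i)

/-- A minimum-length covering strategy: a tuple of walks covering all vertices whose
total length is no larger than that of any covering strategy with the same starts. -/
def IsMinCover [DecidableEq V] (G : SimpleGraph V) {k : ℕ} (S : Fin k → List V) : Prop :=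
  (∀ i, IsWalk G (S i)) ∧ Covers S ∧
    ∀ S' : Fin k → List V, (∀ i, IsWalk G (S' i)) → Covers S' →
      (∀ i, (S' i).head? = (S i).head?) → slen S ≤ slen S'

/-- The forest of twice-traversed edges of walk W, as a subgraph of G. -/
def Fgraph [DecidableEq V] (G : SimpleGraph V) (W : List V) : SimpleGraph V :=
  SimpleGraph.fromRel (fun x y => G.Adj x y ∧ trav W x y = 2)


/-! Helper lemmas on walks as lists. -/

theorem wsteps_cons2 (x y : V) (l : List V) : wsteps (x :: y :: l) = (x, y) :: wsteps (y :: l) := rfl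

theorem wsteps_single (x : V) : wsteps [x] = [] := rfl

theorem wsteps_append (A : List V) (x : V) (D : List V) :
    wsteps (A ++ x :: D) = wsteps (A ++ [x]) ++ wsteps (x :: D) := by
  induction A with
  | nil => simp [wsteps_single]
  | cons c A ih =>
    cases A with
    | nil => simp [wsteps_cons2, wsteps_single]
    | cons d A => simpa [wsteps_cons2] using ih

theorem wsteps_reverse (l : List V) : wsteps l.reverse = ((wsteps l).map Prod.swap).reverse := by
  induction l with
  | nil => rfl
  | cons c l ih =>
    cases l with
    | nil => rfl
    | cons d l =>
      have : (c :: d :: l).reverse = l.reverse ++ d :: [c] := by simp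
      rw [this, wsteps_append, wsteps_cons2]
      have h2 : l.reverse ++ [d] = (d :: l).reverse := by simp
      rw [h2, ih]
      simp [wsteps_cons2, wsteps_single]

theorem mem_of_mem_wsteps {l : List V} {p : V × V} (h : p ∈ wsteps l) : p.1 ∈ l ∧ p.2 ∈ l := by
  obtain ⟨x, y⟩ := p
  have := List.of_mem_zip h
  exact ⟨this.1, List.mem_of_mem_tail this.2⟩

theorem exists_split (p : V × V → Bool) (W : List V) (n : ℕ)
    (h : (wsteps W).countP p = n + 1) :
    ∃ A x y D, W = A ++ x :: y :: D ∧ p (x, y) = true ∧ (wsteps (A ++ [x])).countP p = 0 ∧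
      (wsteps (y :: D)).countP p = n := by
  induction W with
  | nil => simp [wsteps] at h
  | cons c W ih =>
    cases W with
    | nil => simp [wsteps] at h
    | cons d W =>
      rw [wsteps_cons2, List.countP_cons] at h
      by_cases hp : p (c, d) = true
      · refine ⟨[], c, d, W, rfl, hp, by simp [wsteps_single], ?_⟩
        simpa [hp] using h
      · obtain ⟨A, x, y, D, h1, h2, h3, h4⟩ := ih (by simpa [hp] using h)
        refine ⟨c :: A, x, y, D, by simp [h1], h2, ?_, h4⟩
        cases A with
        | nil =>
          simp only [List.nil_append, List.cons.injEq] at h1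
          obtain ⟨rfl, rfl⟩ := h1
          simpa [wsteps_cons2, wsteps_single] using hp
        | cons e A =>
          simp only [List.cons_append, List.cons.injEq] at h1
          obtain ⟨rfl, rfl⟩ := h1
          simp only [List.cons_append] at h3 ⊢
          rw [wsteps_cons2, List.countP_cons, h3]
          simp [hp]

theorem trav_le_one_of_nodup [DecidableEq V] (l : List V) (hl : l.Nodup) (a b : V) :
    trav l a b ≤ 1 := by
  by_contra hcon
  obtain ⟨n, hn⟩ : ∃ n, trav l a b = n + 1 + 1 := ⟨trav l a b - 2, by omega⟩
  obtain ⟨A, x, y, D, h1, h2, -, h4⟩ := exists_split _ _ _ hn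
  have : 0 < List.countP (fun p : V × V => decide ((p.1 = a ∧ p.2 = b) ∨ (p.1 = b ∧ p.2 = a)))
    (wsteps (y :: D)) := by omega
  obtain ⟨q, hq, hq2⟩ := List.countP_pos_iff.1 this
  have hm := mem_of_mem_wsteps hq
  have hx : x ∈ y :: D := by
    simp only [decide_eq_true_eq] at h2 hq2
    grind
  rw [h1] at hl
  have := (List.nodup_append.1 hl).2.1
  exact (List.nodup_cons.1 this).1 hx

theorem reach_of_trav_zero [DecidableEq V] (G : SimpleGraph V) (a b : V) (l : List V)
    (hl : ∀ p ∈ wsteps l, p.1 = p.2 ∨ G.Adj p.1 p.2) (h0 : trav l a b = 0) :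
    ∀ x ∈ l, ∀ y ∈ l, (G.deleteEdges {s(a, b)}).Reachable x y := by
  suffices h : ∀ x ∈ l, ∀ c ∈ l.head?, (G.deleteEdges {s(a, b)}).Reachable c x by
    intro x hx y hy
    cases l with
    | nil => simp at hx
    | cons c l => exact (h x hx c rfl).symm.trans (h y hy c rfl)
  induction l with
  | nil => simp
  | cons c l ih =>
    cases l with
    | nil => simp
    | cons d l =>
      rw [trav, wsteps_cons2, List.countP_cons] at h0
      have h1 := ih (fun p hp => hl p (by rw [wsteps_cons2]; exact List.mem_cons_of_mem _ hp))
        (by rw [trav]; omega)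
      have hcd : (G.deleteEdges {s(a, b)}).Reachable c d := by
        rcases hl (c, d) (by rw [wsteps_cons2]; exact List.mem_cons_self) with h | h
        · simp only at h; rw [h]
        · apply SimpleGraph.Adj.reachable
          rw [SimpleGraph.deleteEdges_adj]
          refine ⟨h, ?_⟩
          intro h'
          have : (c = a ∧ d = b) ∨ (c = b ∧ d = a) := by simpa using h'
          simp [this] at h0
      intro x hx c' hc'
      simp only [List.head?_cons, Option.mem_def, Option.some.injEq] at hc'
      subst hc'
      rcases List.mem_cons.1 hx with rfl | hx
      · rfl
      · exact hcd.trans (h1 x hx d rfl)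

theorem wlen_append [DecidableEq V] (A : List V) (x : V) (D : List V) :
    wlen (A ++ x :: D) = wlen (A ++ [x]) + wlen (x :: D) := by
  simp only [wlen]; rw [wsteps_append, List.countP_append]

theorem wlen_cons2 [DecidableEq V] (x y : V) (D : List V) :
    wlen (x :: y :: D) = wlen (y :: D) + if x = y then 0 else 1 := by
  simp only [wlen, wsteps_cons2, List.countP_cons]
  by_cases h : x = y <;> simp [h]

theorem wlen_reverse [DecidableEq V] (l : List V) : wlen l.reverse = wlen l := by
  simp only [wlen, wsteps_reverse, List.countP_reverse, List.countP_map]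
  congr 1
  funext p
  simp [eq_comm]

/-- The step relation of walks. -/
def StepOk (G : SimpleGraph V) (l : List V) : Prop := ∀ p ∈ wsteps l, p.1 = p.2 ∨ G.Adj p.1 p.2

theorem stepOk_append (G : SimpleGraph V) (A : List V) (x : V) (D : List V) :
    StepOk G (A ++ x :: D) ↔ StepOk G (A ++ [x]) ∧ StepOk G (x :: D) := by
  simp only [StepOk, wsteps_append A x D, List.mem_append, or_imp, forall_and]

theorem stepOk_cons2 (G : SimpleGraph V) (x y : V) (D : List V) :
    StepOk G (x :: y :: D) ↔ (x = y ∨ G.Adj x y) ∧ StepOk G (y :: D) := by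
  simp [StepOk, wsteps_cons2]

theorem stepOk_reverse (G : SimpleGraph V) {l : List V} (h : StepOk G l) :
    StepOk G l.reverse := by
  intro p hp
  rw [wsteps_reverse, List.mem_reverse, List.mem_map] at hp
  obtain ⟨q, hq, rfl⟩ := hp
  rcases h q hq with h | h
  · exact Or.inl h.symm
  · exact Or.inr h.symm

/-- Joining two walks at a repeated vertex. -/
theorem join_eq [DecidableEq V] (G : SimpleGraph V) {l m : List V} {z : V}
    (hl : l.getLast? = some z) (hm : m.head? = some z) :
    wlen (l ++ m) = wlen l + wlen m ∧ (StepOk G (l ++ m) ↔ StepOk G l ∧ StepOk G m) := by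
  obtain ⟨l, rfl⟩ := List.getLast?_eq_some_iff.1 hl
  obtain ⟨m, rfl⟩ := List.head?_eq_some_iff.1 hm
  have : l ++ [z] ++ z :: m = l ++ z :: z :: m := by simp
  rw [this, wlen_append, wlen_cons2, stepOk_append, stepOk_cons2]
  simp

theorem slen_update [DecidableEq V] {k : ℕ} (S : Fin k → List V) (i : Fin k) (X : List V) :
    slen (Function.update S i X) + wlen (S i) = slen S + wlen X := by
  unfold slen
  rw [← Finset.add_sum_erase _ _ (Finset.mem_univ i),
    ← Finset.add_sum_erase _ (fun j => wlen (S j)) (Finset.mem_univ i)]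
  have : ∑ x ∈ Finset.univ.erase i, wlen (Function.update S i X x)
      = ∑ x ∈ Finset.univ.erase i, wlen (S x) := by
    apply Finset.sum_congr rfl
    intro x hx
    rw [Function.update_of_ne (Finset.ne_of_mem_erase hx)]
  rw [this, Function.update_self]
  omega

theorem dirTrav_le_one [DecidableEq V] (G : SimpleGraph V) {k : ℕ} (S : Fin k → List V)
    (hS : IsMinCover G S) (i : Fin k) (a b : V) (hab : a ≠ b) : dirTrav (S i) a b ≤ 1 := by
  by_contra hcon
  obtain ⟨n, hn⟩ : ∃ n, dirTrav (S i) a b = n + 1 + 1 := ⟨dirTrav (S i) a b - 2, by omega⟩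
  obtain ⟨A, x, y, D, h1, h2, -, h4⟩ := exists_split _ _ _ hn
  simp only [decide_eq_true_eq] at h2
  obtain ⟨rfl, rfl⟩ := h2
  obtain ⟨B, x', y', E, h5, h6, -, -⟩ := exists_split _ _ _ h4
  simp only [decide_eq_true_eq] at h6
  obtain ⟨rfl, rfl⟩ := h6
  obtain ⟨hW, hC, hmin⟩ := hS
  have hBh : (B ++ [x']).head? = some y' := by
    cases B with
    | nil => simp at h5; exact absurd h5.1.symm hab
    | cons c B => simp at h5 ⊢; exact h5.1.symm
  have hMl : (B ++ [x']).reverse.getLast? = some y' := by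
    rw [List.getLast?_reverse, hBh]
  have hMh : (B ++ [x']).reverse.head? = some x' := by simp
  have hSi : S i = A ++ x' :: (B ++ x' :: y' :: E) := by rw [h1, h5]
  set X := (A ++ [x']) ++ ((B ++ [x']).reverse ++ (y' :: E)) with hX
  have j1 := join_eq G (l := (B ++ [x']).reverse) (m := y' :: E) hMl rfl
  have j2 := join_eq G (l := A ++ [x']) (m := (B ++ [x']).reverse ++ (y' :: E)) (z := x')
    (by simp) (by simp)
  have hok : StepOk G (S i) := (hW i).2
  have hlen : wlen (S i) = wlen (A ++ [x']) + (1 + (wlen (B ++ [x']) + (1 + wlen (y' :: E)))) := by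
    have e : B ++ x' :: y' :: E = y' :: D := h5.symm
    have e2 := wlen_append B x' (y' :: E)
    rw [hSi, wlen_append, e, wlen_cons2, ← e, e2, wlen_cons2]
    simp [hab]; omega
  have hok1 : StepOk G (A ++ [x']) ∧ StepOk G (B ++ [x']) ∧ StepOk G (y' :: E) := by
    rw [h1, stepOk_append, stepOk_cons2, h5, stepOk_append G B, stepOk_cons2] at hok
    tauto
  have hXok : IsWalk G X := by
    refine ⟨by simp [hX], ?_⟩
    exact j2.2.2 ⟨hok1.1, j1.2.2 ⟨stepOk_reverse G hok1.2.1, hok1.2.2⟩⟩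
  have := hmin (Function.update S i X) ?_ ?_ ?_
  · have hu := slen_update S i X
    have hXl : wlen X = _ := j2.1
    rw [j1.1, wlen_reverse] at hXl
    omega
  · intro l
    by_cases hl : l = i
    · subst hl; simpa using hXok
    · simpa [hl] using hW l
  · intro v
    obtain ⟨l, hl⟩ := hC v
    refine ⟨l, ?_⟩
    by_cases hli : l = i
    · subst hli
      rw [hSi] at hl
      simp [hX] at hl ⊢
      tauto
    · simpa [hli] using hl
  · intro l
    by_cases hli : l = i
    · subst hli
      rw [Function.update_self, hSi, hX]
      cases A <;> simp
    · simp [hli]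

theorem trav_le [DecidableEq V] (W : List V) (a b : V) :
    trav W a b ≤ dirTrav W a b + dirTrav W b a := by
  unfold trav dirTrav
  induction wsteps W with
  | nil => simp
  | cons p l ih =>
    simp only [List.countP_cons, decide_eq_true_eq]
    grind

theorem mem_of_trav_pos [DecidableEq V] {W : List V} {a b : V} (h : 0 < trav W a b) :
    a ∈ W ∧ b ∈ W := by
  obtain ⟨q, hq, hq2⟩ := List.countP_pos_iff.1 h
  have hm := mem_of_mem_wsteps hq
  simp only [decide_eq_true_eq] at hq2
  grind

theorem trav_comm [DecidableEq V] (W : List V) (a b : V) : trav W a b = trav W b a := by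
  unfold trav
  congr 1
  funext p
  simp only [or_comm]

theorem fgraph_adj [DecidableEq V] (G : SimpleGraph V) (W : List V) (a b : V) :
    (Fgraph G W).Adj a b ↔ G.Adj a b ∧ trav W a b = 2 := by
  unfold Fgraph
  rw [SimpleGraph.fromRel_adj, trav_comm W b a, G.adj_comm b a]
  constructor
  · rintro ⟨-, h | h⟩ <;> exact h
  · exact fun h => ⟨h.1.ne, Or.inl h⟩

theorem exists_path_vertex [DecidableEq V] (G : SimpleGraph V) {k : ℕ} (S : Fin k → List V)
    (hS : IsMinCover G S) (i : Fin k) (Q : List V) (hh : Q.head? = (S i).head?)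
    (hQ : ∀ x y : V, G.Adj x y → trav (S i) x y = 1 → trav Q x y = 1) :
    ∀ v ∈ S i, ∃ u ∈ Q, (Fgraph G (S i)).Reachable v u := by
  have key : ∀ l : List V, (∀ p ∈ wsteps l, p ∈ wsteps (S i)) →
      (∀ c ∈ l.head?, ∃ u ∈ Q, (Fgraph G (S i)).Reachable c u) →
      ∀ v ∈ l, ∃ u ∈ Q, (Fgraph G (S i)).Reachable v u := by
    intro l
    induction l with
    | nil => simp
    | cons c l ih =>
      intro h1 h2 v hv
      rcases List.mem_cons.1 hv with rfl | hv
      · exact h2 v rfl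
      cases l with
      | nil => simp at hv
      | cons d l =>
        refine ih (fun p hp => h1 p (by rw [wsteps_cons2]; exact List.mem_cons_of_mem _ hp)) ?_ v hv
        intro d' hd'
        simp only [List.head?_cons, Option.mem_def, Option.some.injEq] at hd'
        subst hd'
        have hm := h1 (c, d) (by rw [wsteps_cons2]; exact List.mem_cons_self)
        obtain ⟨u, hu, hr⟩ := h2 c rfl
        rcases (hS.1 i).2 _ hm with h | h
        · simp only at h; subst h; exact ⟨u, hu, hr⟩
        · simp only at h
          have hpos : 0 < trav (S i) c d :=
            List.countP_pos_iff.2 ⟨(c, d), hm, by simp⟩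
          have h3 := trav_le (S i) c d
          have h4 := dirTrav_le_one G S hS i c d h.ne
          have h5 := dirTrav_le_one G S hS i d c h.ne'
          have h6 : trav (S i) c d = 1 ∨ trav (S i) c d = 2 := by omega
          rcases h6 with h6 | h6
          · have := hQ c d h h6
            exact ⟨d, (mem_of_trav_pos (by omega : 0 < trav Q c d)).2, SimpleGraph.Reachable.refl _⟩
          · have : (Fgraph G (S i)).Adj d c := ((fgraph_adj G (S i) c d).2 ⟨h, h6⟩).symm
            exact ⟨u, hu, this.reachable.trans hr⟩
  refine key (S i) (fun p hp => hp) ?_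
  intro c hc
  refine ⟨c, ?_, SimpleGraph.Reachable.refl _⟩
  rw [← hh] at hc
  exact List.mem_of_mem_head? hc

theorem stepOk_of_chain (G : SimpleGraph V) {l : List V} (h : l.IsChain G.Adj) : StepOk G l := by
  induction l with
  | nil => intro p hp; simp [wsteps] at hp
  | cons c l ih =>
    cases l with
    | nil => intro p hp; simp [wsteps] at hp
    | cons d l =>
      rw [List.isChain_cons_cons] at h
      exact (stepOk_cons2 G c d l).2 ⟨Or.inr h.1, ih h.2⟩

/-- The first edge of a path: after deleting it, the end stays joined
to its far endpoint. -/
theorem first_edge [DecidableEq V] {G F : SimpleGraph V} (hFG : F ≤ G) {u u' : V} (hne : u ≠ u')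
    (h : F.Reachable u u') :
    ∃ y, F.Adj u y ∧ (G.deleteEdges {s(u, y)}).Reachable y u' := by
  obtain ⟨p, hp⟩ := h.exists_isPath
  cases p with
  | nil => exact absurd rfl hne
  | cons hadj p =>
    rename_i y
    refine ⟨y, hadj, ?_⟩
    rw [SimpleGraph.Walk.cons_isPath_iff] at hp
    refine ⟨p.transfer _ ?_⟩
    intro e he
    rw [SimpleGraph.edgeSet_deleteEdges]
    refine ⟨SimpleGraph.edgeSet_mono hFG (p.edges_subset_edgeSet he), ?_⟩
    rintro rfl
    exact hp.2 (p.fst_mem_support_of_mem_edges he)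

set_option maxHeartbeats 2000000 in
theorem transfer_contra [DecidableEq V] (G : SimpleGraph V) (hT : G.IsTree)
    {k : ℕ} (S P : Fin k → List V) (hS : IsMinCover G S)
    (hP : ∀ i, (P i).Nodup ∧ (P i).IsChain G.Adj ∧ (P i).head? = (S i).head? ∧
      (∀ x ∈ P i, x ∈ S i) ∧
      ∀ x y : V, G.Adj x y → (trav (S i) x y = 1 ↔ trav (P i) x y = 1))
    (i : Fin k) (u y u' : V) (hadj : (Fgraph G (S i)).Adj u y)
    (hreach : (G.deleteEdges {s(u, y)}).Reachable y u')
    (hu : ∃ j, u ∈ P j) (hu' : ∃ j, u' ∈ P j) (hui : u ∈ S i) (hui' : u' ∈ S i) : False := by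
  rw [fgraph_adj] at hadj
  obtain ⟨hG, htr⟩ := hadj
  obtain ⟨A, a, b, D, h1, h2, h3, h4⟩ := exists_split _ _ 1 htr
  simp only [decide_eq_true_eq] at h2
  -- there is `w` on the `b`-side
  obtain ⟨w, ⟨j, hwj⟩, hwi, hwb⟩ : ∃ w, (∃ j, w ∈ P j) ∧ w ∈ S i ∧
      (G.deleteEdges {s(a, b)}).Reachable b w := by
    rcases h2 with ⟨rfl, rfl⟩ | ⟨rfl, rfl⟩
    · exact ⟨u', hu', hui', hreach⟩
    · exact ⟨b, hu, hui, SimpleGraph.Reachable.refl _⟩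
  have hGab : G.Adj a b := by
    rcases h2 with ⟨rfl, rfl⟩ | ⟨rfl, rfl⟩
    · exact hG
    · exact hG.symm
  have h2' : (u = a ∧ y = b) ∨ (u = b ∧ y = a) := by grind
  have htrav : ∀ l, trav l u y = trav l a b := by
    intro l
    rcases h2' with ⟨rfl, rfl⟩ | ⟨rfl, rfl⟩
    · rfl
    · exact trav_comm _ _ _
  change trav _ u y = 0 at h3
  change trav _ u y = 1 at h4
  rw [htrav] at h3 h4 htr
  clear h2 h2' htrav hu hu' hui hui' hreach
  have hbridge : ¬ (G.deleteEdges {s(a, b)}).Reachable a b := by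
    have := SimpleGraph.isAcyclic_iff_forall_adj_isBridge.1 hT.isAcyclic hGab
    rw [SimpleGraph.isBridge_iff] at this
    exact this
  obtain ⟨B, x', y', E, h5, h6, h7, h8⟩ := exists_split _ _ 0 h4
  change trav _ a b = 0 at h7
  change trav _ a b = 0 at h8
  simp only [decide_eq_true_eq] at h6
  have hok : StepOk G (S i) := (hS.1 i).2
  have hok' := hok
  rw [h1, stepOk_append, stepOk_cons2, h5, stepOk_append G B, stepOk_cons2] at hok'
  obtain ⟨okA, -, okB, -, okE⟩ := hok'
  have hbB : (B ++ [x']).head? = some b := by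
    cases B with
    | nil => simp at h5 ⊢; exact h5.1.symm
    | cons c B => simp at h5 ⊢; exact h5.1.symm
  have rB := reach_of_trav_zero G a b _ okB h7
  have rA := reach_of_trav_zero G a b _ okA h3
  have rE := reach_of_trav_zero G a b _ okE h8
  have hb_mem : b ∈ B ++ [x'] := List.mem_of_mem_head? hbB
  have hxy : x' = b ∧ y' = a := by
    rcases h6 with ⟨rfl, rfl⟩ | h6
    · exact absurd (rB x' (by simp) y' hb_mem) hbridge
    · exact h6
  obtain ⟨rfl, rfl⟩ := hxy
  have hSi : S i = A ++ y' :: (x' :: D) := h1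
  have hwM : w ∈ B ++ [x'] := by
    rw [hSi, h5] at hwi
    have hw : w ∈ A ++ [y'] ∨ w ∈ B ++ [x'] ∨ w ∈ y' :: E := by
      simp at hwi ⊢; tauto
    rcases hw with hw | hw | hw
    · exact absurd ((rA y' (by simp) w hw).trans hwb.symm) hbridge
    · exact hw
    · exact absurd ((rE y' (by simp) w hw).trans hwb.symm) hbridge
  have hji : j ≠ i := by
    rintro rfl
    obtain ⟨p1, p2, p3, p4, p5⟩ := hP j
    have q1 := trav_le_one_of_nodup _ p1 y' x'
    have q2 : trav (P j) y' x' ≠ 1 := by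
      intro h
      have := (p5 y' x' hGab).2 h
      omega
    have q3 := reach_of_trav_zero G y' x' _ (stepOk_of_chain G p2) (by omega)
    have hAh : (S j).head? = (A ++ [y']).head? := by
      rw [hSi]; cases A <;> simp
    obtain ⟨c, hc⟩ : ∃ c, (A ++ [y']).head? = some c := by cases A <;> simp
    have c1 : c ∈ A ++ [y'] := List.mem_of_mem_head? hc
    have c2 : c ∈ P j := by
      apply List.mem_of_mem_head?
      rw [p3, hAh, hc]; rfl
    exact hbridge (((rA y' (by simp) c c1).trans (q3 c c2 w hwj)).trans hwb.symm)
  have hwSj : w ∈ S j := (hP j).2.2.2.1 w hwj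
  obtain ⟨M1, M2, hM⟩ := List.append_of_mem hwM
  obtain ⟨E1, E2, hE⟩ := List.append_of_mem hwSj
  have okj : StepOk G (S j) := (hS.1 j).2
  rw [hE, stepOk_append] at okj
  have hM1 : (M1 ++ [w]).head? = some x' := by
    rw [← hbB, hM]; cases M1 <;> simp
  have hM2 : (w :: M2).getLast? = some x' := by
    have : (B ++ [x']).getLast? = some x' := by simp
    rw [hM] at this
    simpa [List.getLast?_append] using this
  have okM := okB
  rw [hM, stepOk_append] at okM
  set X := A ++ y' :: E with hX
  set Y := (E1 ++ [w]) ++ (((w :: M2) ++ (M1 ++ [w])) ++ (w :: E2)) with hY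
  have j1 := join_eq G hM2 hM1
  have j2 := join_eq G (l := (w :: M2) ++ (M1 ++ [w])) (m := w :: E2) (z := w)
    (by rw [← List.append_assoc, List.getLast?_append]; rfl) rfl
  have j3 := join_eq G (l := E1 ++ [w]) (m := ((w :: M2) ++ (M1 ++ [w])) ++ (w :: E2)) (z := w)
    (by simp) rfl
  have lenY : wlen Y = wlen (S j) + wlen (B ++ [x']) := by
    rw [hY, j3.1, j2.1, j1.1, hE, wlen_append E1 w E2, hM, wlen_append M1 w M2]
    omega
  have lenX : wlen (S i) = wlen X + wlen (B ++ [x']) + 2 := by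
    have e1 := wlen_append B x' (y' :: E)
    rw [hSi, wlen_append, wlen_cons2, h5, e1, wlen_cons2, hX, wlen_append A y' E]
    simp [hGab.ne, hGab.ne']
    omega
  have okX : IsWalk G X := ⟨by simp [hX], (stepOk_append G A y' E).2 ⟨okA, okE⟩⟩
  have okY : IsWalk G Y := ⟨by simp [hY], j3.2.2 ⟨okj.1, j2.2.2 ⟨j1.2.2 ⟨okM.2, okM.1⟩, okj.2⟩⟩⟩
  have hmin := hS.2.2 (Function.update (Function.update S i X) j Y) ?_ ?_ ?_
  · have s1 := slen_update S i X
    have s2 := slen_update (Function.update S i X) j Y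
    rw [Function.update_of_ne hji] at s2
    omega
  · intro l
    by_cases hl : l = j
    · subst hl; simpa using okY
    · rw [Function.update_of_ne hl]
      by_cases hl2 : l = i
      · subst hl2; simpa using okX
      · simpa [hl2] using hS.1 l
  · intro v
    obtain ⟨l, hl⟩ := hS.2.1 v
    by_cases hlj : l = j
    · subst hlj
      refine ⟨l, ?_⟩
      rw [Function.update_self]
      rw [hE] at hl
      simp [hY] at hl ⊢
      tauto
    · by_cases hli : l = i
      · subst hli
        have hv : v ∈ X ∨ v ∈ B ++ [x'] := by
          rw [hSi, h5] at hl
          simp [hX] at hl ⊢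
          tauto
        rcases hv with hv | hv
        · exact ⟨l, by rw [Function.update_of_ne hlj, Function.update_self]; exact hv⟩
        · refine ⟨j, ?_⟩
          rw [Function.update_self]
          rw [hM] at hv
          simp [hY] at hv ⊢
          tauto
      · exact ⟨l, by rw [Function.update_of_ne hlj, Function.update_of_ne hli]; exact hl⟩
  · intro l
    by_cases hl : l = j
    · subst hl
      rw [Function.update_self, hE, hY]
      cases E1 <;> simp
    · rw [Function.update_of_ne hl]
      by_cases hl2 : l = i
      · subst hl2
        rw [Function.update_self, hSi, hX]
        cases A <;> simp
      · simp [hl2]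

/-- Structure lemma (part (c)): each connected component of each forest F(Wᵢ)
meets the union of the vertex sets of the paths P(W₁),…,P(Wₖ) in exactly one vertex. -/
theorem stmt4 {V : Type*} [Fintype V] [DecidableEq V] (G : SimpleGraph V) (hT : G.IsTree)
    {k : ℕ} (S P : Fin k → List V) (hS : IsMinCover G S)
    (hP : ∀ i, (P i).Nodup ∧ (P i).Chain' G.Adj ∧ (P i).head? = (S i).head? ∧
      (∀ x ∈ P i, x ∈ S i) ∧
      ∀ x y : V, G.Adj x y → (trav (S i) x y = 1 ↔ trav (P i) x y = 1))
    (i : Fin k) (v : V) (hv : ∃ w, (Fgraph G (S i)).Adj v w) :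
    ∃! u : V, (Fgraph G (S i)).Reachable v u ∧ ∃ j : Fin k, u ∈ P j := by
  have hP' : ∀ i, (P i).Nodup ∧ (P i).IsChain G.Adj ∧ (P i).head? = (S i).head? ∧
      (∀ x ∈ P i, x ∈ S i) ∧
      ∀ x y : V, G.Adj x y → (trav (S i) x y = 1 ↔ trav (P i) x y = 1) := hP
  have hmem : ∀ x y, (Fgraph G (S i)).Adj x y → x ∈ S i := by
    intro x y h
    rw [fgraph_adj] at h
    exact (mem_of_trav_pos (by omega : 0 < trav (S i) x y)).1
  have hFG : Fgraph G (S i) ≤ G := fun x y h => ((fgraph_adj G (S i) x y).1 h).1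
  obtain ⟨w, hw⟩ := hv
  obtain ⟨u, hu, hr⟩ := exists_path_vertex G S hS i (P i) (hP' i).2.2.1
    (fun x y h => ((hP' i).2.2.2.2 x y h).1) v (hmem v w hw)
  refine ⟨u, ⟨hr, i, hu⟩, ?_⟩
  rintro u' ⟨hr', hu'⟩
  by_contra hne
  have hr2 : (Fgraph G (S i)).Reachable u' u := hr'.symm.trans hr
  obtain ⟨y, hy, hyr⟩ := first_edge hFG hne hr2
  obtain ⟨z, hz, -⟩ := first_edge hFG (Ne.symm hne) hr2.symm
  exact transfer_contra G hT S P hS hP' i u' y u hy hyr hu' ⟨i, hu⟩ (hmem _ _ hy) (hmem _ _ hz)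
end

section
/- Let T be a tree rooted at u, let v be a vertex with children v_1,...,v_m, and let T_v[i] be the union of the subtrees rooted at v's first i children together with the edges joining them to v. Let C[v,i,j] denote the minimum length of a covering strategy for T_v[i] with j robots all starting at v (where C[v,i,0] is twice the number of edges of T_v[i]). Then C[v,i,j] = min( C[v,i-1,j] + C[v_i, deg(v_i), 0] + 2, min_{1 ≤ l ≤ j} ( C[v,i-1,j-l] + C[v_i, deg(v_i), l] + l ) ). -/
open Finset

variable {V : Type*}

/-- A walk in G confined to the vertex set U. -/
def ConfinedWalk (G : SimpleGraph V) (U : Set V) (W : List V) : Prop :=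
  IsWalk G W ∧ ∀ x ∈ W, x ∈ U

/-- C[·,·,j]: for j ≥ 1, the minimum total length of a covering strategy for the
subtree on vertex set U with j robots all starting at v; for j = 0, twice the
number of edges of the subtree on U (the cost of one robot returning to v). -/
noncomputable def mcc {V : Type*} [DecidableEq V] (G : SimpleGraph V) (U : Set V)
    (v : V) : ℕ → ℕ
  | 0 => 2 * (U.ncard - 1)
  | (j + 1) => sInf {L : ℕ | ∃ S : Fin (j + 1) → List V,
      (∀ i, ConfinedWalk G U (S i)) ∧ (∀ x ∈ U, ∃ i, x ∈ S i) ∧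
      (∀ i, (S i).head? = some v) ∧ slen S = L}

/-- The graph G with the vertex v (and all its incident edges) removed. -/
def delV (G : SimpleGraph V) (v : V) : SimpleGraph V :=
  SimpleGraph.fromRel (fun x y => G.Adj x y ∧ x ≠ v ∧ y ≠ v)

/-- The vertex set of the subtree hanging below the child c of v. -/
def Dset (G : SimpleGraph V) (v c : V) : Set V := {x | (delV G v).Reachable c x}

/-- The vertex set of T_v[i]: v together with the subtrees of the first i children. -/
def Uset (G : SimpleGraph V) (v : V) {m : ℕ} (c : Fin m → V) (i : ℕ) : Set V :=
  insert v (⋃ (l : Fin m) (_ : (l : ℕ) < i), Dset G v (c l))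

section Helpers

set_option linter.unusedSectionVars false

variable [DecidableEq V]

lemma wsteps_cons_cons (a b : V) (l : List V) :
    wsteps (a :: b :: l) = (a, b) :: wsteps (b :: l) := rfl

lemma wsteps_append_s18 {W₁ W₂ : List V} {a b : V} (h1 : W₁.getLast? = some a)
    (h2 : W₂.head? = some b) :
    wsteps (W₁ ++ W₂) = wsteps W₁ ++ (a, b) :: wsteps W₂ := by
  induction W₁ with
  | nil => simp at h1
  | cons x l ih =>
    cases l with
    | nil =>
      cases W₂ with
      | nil => simp at h2
      | cons y l2 =>
        simp at h1 h2
        subst h1 h2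
        rfl
    | cons y l =>
      have := ih (by simpa using h1)
      simp only [List.cons_append] at this ⊢
      rw [wsteps_cons_cons, this, wsteps_cons_cons]
      rfl

lemma wsteps_map {α β : Type*} (f : α → β) (W : List α) :
    wsteps (W.map f) = (wsteps W).map (Prod.map f f) := by
  simp [wsteps, ← List.map_tail, List.zip_map]

lemma mem_of_wsteps {W : List V} {p : V × V} (h : p ∈ wsteps W) : p.1 ∈ W ∧ p.2 ∈ W := by
  obtain ⟨a, b⟩ := p
  exact ⟨(List.of_mem_zip h).1, List.mem_of_mem_tail (List.of_mem_zip h).2⟩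

/-- confined walk starting at `v` -/
def Wk (G : SimpleGraph V) (U : Set V) (v : V) (W : List V) : Prop :=
  ConfinedWalk G U W ∧ W.head? = some v

lemma wlen_append_s18 {W₁ W₂ : List V} {a : V} (h1 : W₁.getLast? = some a)
    (h2 : W₂.head? = some a) : wlen (W₁ ++ W₂) = wlen W₁ + wlen W₂ := by
  simp [wlen, wsteps_append_s18 h1 h2]

lemma wlen_append_ne {W₁ W₂ : List V} {a b : V} (h1 : W₁.getLast? = some a)
    (h2 : W₂.head? = some b) (h : a ≠ b) : wlen (W₁ ++ W₂) = wlen W₁ + wlen W₂ + 1 := by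
  simp [wlen, wsteps_append_s18 h1 h2, h]; omega

lemma Wk.append {G : SimpleGraph V} {U : Set V} {v a b : V} {W₁ W₂ : List V}
    (h1 : Wk G U v W₁) (hl : W₁.getLast? = some a) (h2 : Wk G U b W₂)
    (hab : a = b ∨ G.Adj a b) : Wk G U v (W₁ ++ W₂) := by
  obtain ⟨⟨⟨n1, s1⟩, c1⟩, hd1⟩ := h1
  obtain ⟨⟨⟨n2, s2⟩, c2⟩, hd2⟩ := h2
  refine ⟨⟨⟨by simp [n1], ?_⟩, ?_⟩, ?_⟩
  · rw [wsteps_append_s18 hl hd2]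
    intro p hp
    simp only [List.mem_append, List.mem_cons] at hp
    rcases hp with hp | rfl | hp
    · exact s1 p hp
    · exact hab
    · exact s2 p hp
  · intro x hx
    rcases List.mem_append.1 hx with hx | hx
    · exact c1 x hx
    · exact c2 x hx
  · simp [List.head?_append, hd1]

lemma getLast?_append' {W₁ W₂ : List V} {a : V} (h : W₂.getLast? = some a) :
    (W₁ ++ W₂).getLast? = some a := by simp [List.getLast?_append, h]

lemma Wk.mono {G : SimpleGraph V} {U U' : Set V} {v : V} {W : List V} (h : Wk G U v W)
    (hU : U ⊆ U') : Wk G U' v W :=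
  ⟨⟨h.1.1, fun x hx => hU (h.1.2 x hx)⟩, h.2⟩

lemma Wk.single {G : SimpleGraph V} {U : Set V} {v : V} (h : v ∈ U) : Wk G U v [v] := by
  refine ⟨⟨⟨by simp, ?_⟩, by simpa using h⟩, rfl⟩
  intro p hp
  simp [wsteps] at hp

lemma wlen_single (v : V) : wlen [v] = 0 := rfl

lemma exit_of_head (S : Set V) {W : List V} {a x : V} (h : W.head? = some a) (ha : a ∈ S)
    (hx : x ∈ W) (hxS : x ∉ S) : ∃ p ∈ wsteps W, p.1 ∈ S ∧ p.2 ∉ S := by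
  induction W generalizing a with
  | nil => simp at h
  | cons y l ih =>
    simp at h
    subst h
    cases l with
    | nil => simp at hx; subst hx; exact absurd ha hxS
    | cons z l =>
      rw [wsteps_cons_cons]
      by_cases hz : z ∈ S
      · have hx' : x ∈ z :: l := by
          rcases List.mem_cons.1 hx with rfl | h
          · exact absurd ha hxS
          · exact h
        obtain ⟨p, hp, h⟩ := ih rfl hz hx'
        exact ⟨p, List.mem_cons_of_mem _ hp, h⟩
      · exact ⟨_, List.mem_cons_self, ha, hz⟩

lemma exit_of_last (S : Set V) {W : List V} {a x : V} (h : W.getLast? = some a) (ha : a ∉ S)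
    (hx : x ∈ W) (hxS : x ∈ S) : ∃ p ∈ wsteps W, p.1 ∈ S ∧ p.2 ∉ S := by
  obtain ⟨s, t, rfl⟩ := List.append_of_mem hx
  have h' : (x :: t).getLast? = some a := by
    simpa [List.getLast?_append] using h
  obtain ⟨p, hp, hh⟩ := exit_of_head S (W := x :: t) (a := x) rfl hxS
    (List.mem_of_getLast? h') ha
  refine ⟨p, ?_, hh⟩
  rcases hs : s.getLast? with _ | b
  · simp at hs; subst hs; exact hp
  · rw [wsteps_append_s18 hs (b := x) rfl]
    simp [hp]

lemma closed_symm {G : SimpleGraph V} (hG : G.IsAcyclic) {U : Set V} {v : V} {W : List V}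
    (h : Wk G U v W) (hl : W.getLast? = some v) {a b : V} (hab : (a, b) ∈ wsteps W)
    (hne : a ≠ b) : (b, a) ∈ wsteps W := by
  have hadj : G.Adj a b := by
    rcases h.1.1.2 _ hab with h | h
    · exact absurd h hne
    · exact h
  have hbr := SimpleGraph.isAcyclic_iff_forall_adj_isBridge.1 hG hadj
  rw [SimpleGraph.isBridge_iff] at hbr
  let H := G \ SimpleGraph.fromEdgeSet {s(a, b)}
  let S : Set V := {x | H.Reachable x b}
  have haS : a ∉ S := by
    intro h
    exact hbr h
  have hbS : b ∈ S := SimpleGraph.Reachable.refl _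
  have hm := mem_of_wsteps hab
  have : ∃ p ∈ wsteps W, p.1 ∈ S ∧ p.2 ∉ S := by
    by_cases hv : v ∈ S
    · exact exit_of_head S h.2 hv hm.1 haS
    · exact exit_of_last S hl hv hm.2 hbS
  obtain ⟨⟨x, y⟩, hp, hx, hy⟩ := this
  simp only at hx hy
  have hxy : G.Adj x y := by
    rcases h.1.1.2 _ hp with h | h
    · simp only at h; subst h; exact absurd hx hy
    · exact h
  by_cases he : s(x, y) = s(a, b)
  · rw [Sym2.eq_iff] at he
    rcases he with ⟨rfl, rfl⟩ | ⟨rfl, rfl⟩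
    · exact absurd hx haS
    · exact hp
  · exfalso
    apply hy
    have : H.Adj y x := by
      simp only [H, SimpleGraph.sdiff_adj, SimpleGraph.fromEdgeSet_adj, Set.mem_singleton_iff]
      refine ⟨hxy.symm, fun hh => he ?_⟩
      rw [← hh.1, Sym2.eq_swap]
    exact this.reachable.trans hx

lemma exists_steps (W : List V) (hW : W ≠ []) : ∃ E : Finset (V × V),
    E.card + 1 = W.toFinset.card ∧ (∀ p ∈ E, p ∈ wsteps W ∧ p.1 ≠ p.2 ∧ p.swap ∉ E) := by
  induction W with
  | nil => simp at hW
  | cons x l ih =>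
    cases l with
    | nil => exact ⟨∅, by simp⟩
    | cons y l =>
      obtain ⟨E, hc, hE⟩ := ih (by simp)
      by_cases hx : x ∈ y :: l
      · refine ⟨E, ?_, fun p hp => ⟨?_, (hE p hp).2⟩⟩
        · rw [hc, List.toFinset_cons (a := x), Finset.insert_eq_of_mem (by simpa using hx)]
        · rw [wsteps_cons_cons]
          exact List.mem_cons_of_mem _ (hE p hp).1
      · have hxE : ∀ p ∈ E, p.1 ≠ x ∧ p.2 ≠ x := by
          intro p hp
          have := mem_of_wsteps (hE p hp).1
          exact ⟨fun h => hx (h ▸ this.1), fun h => hx (h ▸ this.2)⟩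
        have hxy : x ≠ y := fun h => hx (by simp [h])
        refine ⟨insert (x, y) E, ?_, ?_⟩
        · rw [Finset.card_insert_of_notMem (fun h => (hxE _ h).1 rfl), hc,
            List.toFinset_cons (a := x), Finset.card_insert_of_notMem (by simpa using hx)]
        · intro p hp
          rw [wsteps_cons_cons]
          rcases Finset.mem_insert.1 hp with rfl | hp
          · refine ⟨List.mem_cons_self, hxy, ?_⟩
            intro h
            rcases Finset.mem_insert.1 h with h | h
            · simp at h; exact hxy h.1.symm
            · exact (hxE _ h).2 rfl
          · refine ⟨List.mem_cons_of_mem _ (hE p hp).1, (hE p hp).2.1, ?_⟩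
            intro h
            rcases Finset.mem_insert.1 h with h | h
            · apply (hxE p hp).2
              have := congrArg Prod.fst h
              simpa using this
            · exact (hE p hp).2.2 h

lemma closed_wlen [Fintype V] {G : SimpleGraph V} (hG : G.IsAcyclic) {U : Set V} {v : V}
    {W : List V} (h : Wk G U v W) (hl : W.getLast? = some v) (hc : ∀ x ∈ U, x ∈ W) :
    2 * (U.ncard - 1) ≤ wlen W := by
  obtain ⟨E, hE, hE'⟩ := exists_steps W h.1.1.1
  have hU : U = (W.toFinset : Set V) := by
    ext x
    simp only [Finset.mem_coe, List.mem_toFinset]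
    exact ⟨hc x, h.1.2 x⟩
  rw [hU, Set.ncard_coe_finset, ← hE]
  have hd : Disjoint E (E.image Prod.swap) := by
    rw [Finset.disjoint_left]
    intro p hp hp'
    obtain ⟨q, hq, rfl⟩ := Finset.mem_image.1 hp'
    exact (hE' q hq).2.2 hp
  have hcard : (E.image Prod.swap).card = E.card :=
    Finset.card_image_of_injective _ Prod.swap_injective
  have hsub : E ∪ E.image Prod.swap ⊆
      ((wsteps W).filter (fun p => decide (p.1 ≠ p.2))).toFinset := by
    intro p hp
    rw [List.mem_toFinset, List.mem_filter]
    rcases Finset.mem_union.1 hp with hp | hp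
    · exact ⟨(hE' p hp).1, by simpa using (hE' p hp).2.1⟩
    · obtain ⟨⟨a, b⟩, hq, rfl⟩ := Finset.mem_image.1 hp
      have := hE' _ hq
      exact ⟨closed_symm hG h hl this.1 this.2.1, by simpa using this.2.1.symm⟩
  have h1 := Finset.card_le_card hsub
  rw [Finset.card_union_of_disjoint hd, hcard] at h1
  have h2 := List.toFinset_card_le ((wsteps W).filter (fun p => decide (p.1 ≠ p.2)))
  rw [← List.countP_eq_length_filter] at h2
  unfold wlen
  omega

/-- every vertex of `U` can be reached from `v` within `U` -/
def ConnFrom (G : SimpleGraph V) (U : Set V) (v : V) : Prop :=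
  v ∈ U ∧ ∀ A : Set V, v ∈ A → (∀ x ∈ A, ∀ y ∈ U, G.Adj x y → y ∈ A) → U ⊆ A

lemma exists_tour [Fintype V] {G : SimpleGraph V} {U : Set V} {v : V} (hU : ConnFrom G U v) :
    ∃ W, Wk G U v W ∧ W.getLast? = some v ∧ (∀ x ∈ U, x ∈ W) ∧ wlen W = 2 * (U.ncard - 1) := by
  have key : ∀ n : ℕ, n + 1 ≤ U.ncard → ∃ W, Wk G U v W ∧ W.getLast? = some v ∧
      W.toFinset.card = n + 1 ∧ wlen W = 2 * n := by
    intro n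
    induction n with
    | zero => exact fun _ => ⟨[v], Wk.single hU.1, rfl, by simp, rfl⟩
    | succ n ih =>
      intro hn
      obtain ⟨W, hW, hl, hc, hw⟩ := ih (by omega)
      have : ∃ x ∈ W, ∃ y ∈ U, G.Adj x y ∧ y ∉ W := by
        by_contra hcon
        push Not at hcon
        have hsub := hU.2 {x | x ∈ W} (List.mem_of_mem_head? hW.2) hcon
        have : U ⊆ (W.toFinset : Set V) := fun x hx => by simpa using hsub hx
        have h2 := Set.ncard_le_ncard this
        rw [Set.ncard_coe_finset] at h2
        omega
      obtain ⟨x, hx, y, hy, hxy, hyW⟩ := this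
      have hxU := hW.1.2 x hx
      obtain ⟨s, t, rfl⟩ := List.append_of_mem hx
      have hlen : wlen (s ++ x :: y :: x :: t) = wlen (s ++ x :: t) + 2 := by
        have e : wlen (x :: y :: x :: t) = wlen (x :: t) + 2 := by
          simp only [wlen, wsteps_cons_cons]
          simp [hxy.ne, hxy.ne.symm]
        rcases hs : s.getLast? with _ | b
        · simp at hs; subst hs; exact e
        · have h1 := wsteps_append_s18 hs (W₂ := x :: y :: x :: t) (b := x) rfl
          have h2 := wsteps_append_s18 hs (W₂ := x :: t) (b := x) rfl
          unfold wlen at e ⊢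
          rw [h1, h2]
          simp only [List.countP_append, List.countP_cons, e]
          omega
      refine ⟨s ++ x :: y :: x :: t, ⟨⟨⟨by simp, ?_⟩, ?_⟩, ?_⟩, ?_, ?_, ?_⟩
      · have hst := hW.1.1.2
        have e : ∀ p ∈ wsteps (x :: y :: x :: t), p ∈ wsteps (x :: t) ∨ G.Adj p.1 p.2 := by
          intro p hp
          simp only [wsteps_cons_cons, List.mem_cons] at hp
          rcases hp with rfl | rfl | hp
          · exact Or.inr hxy
          · exact Or.inr hxy.symm
          · exact Or.inl hp
        rcases hs : s.getLast? with _ | b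
        · simp at hs; subst hs
          intro p hp
          rcases e p hp with h | h
          · exact hst p h
          · exact Or.inr h
        · rw [wsteps_append_s18 hs (b := x) rfl] at hst ⊢
          intro p hp
          simp only [List.mem_append, List.mem_cons] at hp hst
          rcases hp with hp | hp | hp
          · exact hst p (Or.inl hp)
          · exact hst p (Or.inr (Or.inl hp))
          · rcases e p hp with h | h
            · exact hst p (Or.inr (Or.inr h))
            · exact Or.inr h
      · intro z hz
        have hz' : z = y ∨ z ∈ s ++ x :: t := by
          simp only [List.mem_append, List.mem_cons] at hz ⊢; tauto
        rcases hz' with rfl | hz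
        · exact hy
        · exact hW.1.2 z hz
      · have := hW.2
        cases s <;> simpa using this
      · simpa [List.getLast?_append] using hl
      · have : (s ++ x :: y :: x :: t).toFinset = insert y (s ++ x :: t).toFinset := by
          ext z
          simp only [List.mem_toFinset, Finset.mem_insert, List.mem_append, List.mem_cons]
          tauto
        rw [this, Finset.card_insert_of_notMem (by rwa [List.mem_toFinset]), hc]
      · rw [hlen, hw]; ring
  have hpos : 0 < U.ncard := (Set.ncard_pos).2 ⟨v, hU.1⟩
  obtain ⟨W, hW, hl, hc, hw⟩ := key (U.ncard - 1) (by omega)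
  refine ⟨W, hW, hl, ?_, hw⟩
  have hsub : (W.toFinset : Set V) ⊆ U := fun x hx => hW.1.2 x (by simpa using hx)
  have := Set.eq_of_subset_of_ncard_le hsub (by rw [Set.ncard_coe_finset]; omega)
  intro x hx
  rw [← this] at hx
  simpa using hx

lemma mcc_le {G : SimpleGraph V} {U : Set V} {v : V} {ι : Type*} [Fintype ι] [Nonempty ι]
    (S : ι → List V) (hS : ∀ k, Wk G U v (S k)) (hc : ∀ x ∈ U, ∃ k, x ∈ S k) :
    mcc G U v (Fintype.card ι) ≤ ∑ k, wlen (S k) := by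
  obtain ⟨n, hn⟩ : ∃ n, Fintype.card ι = n + 1 :=
    ⟨Fintype.card ι - 1, by have := Fintype.card_pos (α := ι); omega⟩
  rw [hn]
  let e := Fintype.equivFinOfCardEq hn
  apply Nat.sInf_le
  refine ⟨fun k => S (e.symm k), fun k => (hS _).1, ?_, fun k => (hS _).2, ?_⟩
  · intro x hx
    obtain ⟨k, hk⟩ := hc x hx
    exact ⟨e k, by simpa using hk⟩
  · exact Equiv.sum_comp e.symm (fun k => wlen (S k))

lemma mcc_le_closed [Fintype V] {G : SimpleGraph V} (hG : G.IsAcyclic) {U : Set V} {v : V}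
    {ι : Type*} [Fintype ι] (S : ι → List V) (hS : ∀ k, Wk G U v (S k))
    (W : List V) (hW : Wk G U v W) (hl : W.getLast? = some v)
    (hc : ∀ x ∈ U, x ∈ W ∨ ∃ k, x ∈ S k) :
    mcc G U v (Fintype.card ι) ≤ wlen W + ∑ k, wlen (S k) := by
  classical
  rcases isEmpty_or_nonempty ι with hι | hι
  · have : mcc G U v (Fintype.card ι) = 2 * (U.ncard - 1) := by
      rw [Fintype.card_eq_zero]; rfl
    rw [this]
    have := closed_wlen hG hW hl (fun x hx => by simpa using hc x hx)
    omega
  · obtain ⟨k0⟩ := hι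
    haveI : Nonempty ι := ⟨k0⟩
    have := mcc_le (G := G) (U := U) (v := v)
      (fun k => if k = k0 then W ++ S k else S k) ?_ ?_
    · refine this.trans (le_of_eq ?_)
      rw [← Finset.add_sum_erase _ _ (Finset.mem_univ k0),
        ← Finset.add_sum_erase _ (fun k => wlen (S k)) (Finset.mem_univ k0)]
      rw [if_pos rfl, wlen_append_s18 hl (hS k0).2, add_assoc]
      congr 2
      apply Finset.sum_congr rfl
      intro k hk
      rw [if_neg (Finset.ne_of_mem_erase hk)]
    · intro k
      by_cases hk : k = k0
      · simp only [hk, if_true]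
        exact hW.append hl (hS k0) (Or.inl rfl)
      · simp only [hk, if_false]
        exact hS k
    · intro x hx
      rcases hc x hx with h | ⟨k, h⟩
      · exact ⟨k0, by simp [h]⟩
      · refine ⟨k, ?_⟩
        by_cases hk : k = k0
        · simp only [hk, if_true]
          subst hk
          simp [h]
        · simp only [hk, if_false]
          exact h

lemma exists_cat {G : SimpleGraph V} {U : Set V} {v : V} (hv : v ∈ U)
    {ι : Type*} [DecidableEq ι] (s : Finset ι) (S : ι → List V) (hS : ∀ k ∈ s, Wk G U v (S k))
    (hl : ∀ k ∈ s, (S k).getLast? = some v) :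
    ∃ W, Wk G U v W ∧ W.getLast? = some v ∧ wlen W = ∑ k ∈ s, wlen (S k) ∧
      ∀ k ∈ s, ∀ x ∈ S k, x ∈ W := by
  induction s using Finset.induction_on with
  | empty => exact ⟨[v], Wk.single hv, rfl, rfl, by simp⟩
  | insert a s ha ih =>
    obtain ⟨W, h1, h2, h3, h4⟩ := ih (fun k hk => hS k (Finset.mem_insert_of_mem hk))
      (fun k hk => hl k (Finset.mem_insert_of_mem hk))
    have ha' := Finset.mem_insert_self a s
    refine ⟨S a ++ W, (hS a ha').append (hl a ha') h1 (Or.inl rfl), getLast?_append' h2, ?_, ?_⟩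
    · rw [wlen_append_s18 (hl a ha') h1.2, Finset.sum_insert ha, h3]
    · intro k hk x hx
      rcases Finset.mem_insert.1 hk with rfl | hk
      · simp [hx]
      · simp [h4 k hk x hx]

/-- lower bound with closed walks not counted -/
lemma mcc_le_split [Fintype V] {G : SimpleGraph V} (hG : G.IsAcyclic) {U : Set V} {v : V}
    (hv : v ∈ U) {ι : Type*} [Fintype ι] [DecidableEq ι] (P : ι → Prop) [DecidablePred P]
    (S : ι → List V) (hS : ∀ k, Wk G U v (S k))
    (hl : ∀ k, ¬ P k → (S k).getLast? = some v) (hc : ∀ x ∈ U, ∃ k, x ∈ S k) :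
    mcc G U v (Fintype.card {k // P k}) ≤ ∑ k, wlen (S k) := by
  obtain ⟨W, h1, h2, h3, h4⟩ := exists_cat hv (Finset.univ.filter (fun k => ¬ P k)) S
    (fun k _ => hS k) (fun k hk => hl k (by simpa using hk))
  have := mcc_le_closed hG (ι := {k // P k}) (fun k => S k) (fun k => hS k) W h1 h2 ?_
  · refine this.trans (le_of_eq ?_)
    rw [h3, ← Finset.sum_filter_add_sum_filter_not Finset.univ P (fun k => wlen (S k)), add_comm]
    congr 1
    exact (Finset.sum_subtype (Finset.univ.filter P) (p := P) (fun k => by simp) (fun k => wlen (S k))).symm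
  · intro x hx
    obtain ⟨k, hk⟩ := hc x hx
    by_cases hP : P k
    · exact Or.inr ⟨⟨k, hP⟩, hk⟩
    · exact Or.inl (h4 k (by simpa using hP) x hk)

lemma exists_opt [Fintype V] {G : SimpleGraph V} {U : Set V} {v : V} (hU : ConnFrom G U v)
    {n : ℕ} (hn : 1 ≤ n) : ∃ S : Fin n → List V, (∀ k, Wk G U v (S k)) ∧
      (∀ x ∈ U, ∃ k, x ∈ S k) ∧ ∑ k, wlen (S k) = mcc G U v n := by
  obtain ⟨n, rfl⟩ : ∃ k, n = k + 1 := ⟨n - 1, by omega⟩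
  have hne : {L : ℕ | ∃ S : Fin (n + 1) → List V,
      (∀ i, ConfinedWalk G U (S i)) ∧ (∀ x ∈ U, ∃ i, x ∈ S i) ∧
      (∀ i, (S i).head? = some v) ∧ slen S = L}.Nonempty := by
    obtain ⟨W, h1, -, h2, -⟩ := exists_tour hU
    exact ⟨_, fun _ => W, fun _ => h1.1, fun x hx => ⟨0, h2 x hx⟩, fun _ => h1.2, rfl⟩
  obtain ⟨S, h1, h2, h3, h4⟩ := Nat.sInf_mem hne
  exact ⟨S, fun k => ⟨h1 k, h3 k⟩, h2, h4⟩

lemma exists_opt_closed [Fintype V] {G : SimpleGraph V} {U : Set V} {v : V}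
    (hU : ConnFrom G U v) (n : ℕ) : ∃ (W : List V) (S : Fin n → List V),
      Wk G U v W ∧ W.getLast? = some v ∧ (∀ k, Wk G U v (S k)) ∧
      (∀ x ∈ U, x ∈ W ∨ ∃ k, x ∈ S k) ∧ wlen W + ∑ k, wlen (S k) = mcc G U v n := by
  rcases Nat.eq_zero_or_pos n with rfl | hn
  · obtain ⟨W, h1, h2, h3, h4⟩ := exists_tour hU
    refine ⟨W, fun _ => [], h1, h2, fun k => k.elim0, fun x hx => Or.inl (h3 x hx), ?_⟩
    simp [h4, mcc]
  · obtain ⟨S, h1, h2, h3⟩ := exists_opt hU hn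
    exact ⟨[v], S, Wk.single hU.1, rfl, h1, fun x hx => Or.inr (h2 x hx), by
      rw [h3, wlen_single, zero_add]⟩

open Classical in
/-- retraction onto `U` -/
noncomputable def retr (U : Set V) (v : V) (x : V) : V := if x ∈ U then x else v

lemma retr_walk {G : SimpleGraph V} {U D : Set V} {v c w : V} (hdis : Disjoint U D)
    (hv : v ∈ U) (hedge : ∀ a ∈ U, ∀ b ∈ D, G.Adj a b → a = v ∧ b = c)
    {W : List V} (hW : Wk G (U ∪ D) w W) : Wk G U (retr U v w) (W.map (retr U v)) := by
  have hD : ∀ x ∈ D, x ∉ U := fun x hx hx' => Set.disjoint_left.1 hdis hx' hx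
  refine ⟨⟨⟨by simpa using hW.1.1.1, ?_⟩, ?_⟩, by simp [hW.2]⟩
  · rw [wsteps_map]
    intro p hp
    obtain ⟨⟨a, b⟩, hq, rfl⟩ := List.mem_map.1 hp
    have hm := mem_of_wsteps hq
    have ha := hW.1.2 _ hm.1
    have hb := hW.1.2 _ hm.2
    simp only [Prod.map_fst, Prod.map_snd] at ha hb ⊢
    rcases hW.1.1.2 _ hq with h | h
    · left; simp only at h; rw [h]
    simp only at h
    unfold retr
    rcases ha with ha | ha <;> rcases hb with hb | hb
    · simp [ha, hb, h]
    · simp [ha, hD b hb, (hedge a ha b hb h).1]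
    · simp [hb, hD a ha, (hedge b hb a ha h.symm).1]
    · simp [hD a ha, hD b hb]
  · intro x hx
    obtain ⟨y, hy, rfl⟩ := List.mem_map.1 hx
    unfold retr
    split_ifs with h
    · exact h
    · exact hv

open Classical in
lemma wlen_split {G : SimpleGraph V} {U D : Set V} {v c w : V} (hdis : Disjoint U D)
    (hedge : ∀ a ∈ U, ∀ b ∈ D, G.Adj a b → a = v ∧ b = c)
    {W : List V} (hW : Wk G (U ∪ D) w W) :
    wlen (W.map (retr U v)) + wlen (W.map (retr D c)) +
      (wsteps W).countP (fun p => decide (p.1 ∈ Dᶜ ∧ p.2 ∉ Dᶜ)) +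
      (wsteps W).countP (fun p => decide (p.1 ∈ D ∧ p.2 ∉ D)) ≤ wlen W := by
  have hD : ∀ x ∈ D, x ∉ U := fun x hx hx' => Set.disjoint_left.1 hdis hx' hx
  have hU' : ∀ x ∈ U, x ∉ D := fun x hx hx' => Set.disjoint_left.1 hdis hx hx'
  have key : ∀ p ∈ wsteps W, p.1 ∈ U ∪ D ∧ p.2 ∈ U ∪ D ∧ (p.1 = p.2 ∨ G.Adj p.1 p.2) :=
    fun p hp => ⟨hW.1.2 _ (mem_of_wsteps hp).1, hW.1.2 _ (mem_of_wsteps hp).2, hW.1.1.2 p hp⟩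
  unfold wlen
  simp only [wsteps_map, List.countP_map]
  generalize wsteps W = L at key
  induction L with
  | nil => simp
  | cons p L ih =>
    have ih := ih (fun p hp => key p (List.mem_cons_of_mem _ hp))
    obtain ⟨ha, hb, hab⟩ := key p List.mem_cons_self
    simp only [List.countP_cons]
    obtain ⟨a, b⟩ := p
    have hstep : (if (((fun p : V × V => decide (p.1 ≠ p.2)) ∘ Prod.map (retr U v) (retr U v)) (a, b)) = true then 1 else 0)
      + (if (((fun p : V × V => decide (p.1 ≠ p.2)) ∘ Prod.map (retr D c) (retr D c)) (a, b)) = true then 1 else 0)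
      + (if (decide ((a, b).1 ∈ Dᶜ ∧ (a, b).2 ∉ Dᶜ)) = true then 1 else 0)
      + (if (decide ((a, b).1 ∈ D ∧ (a, b).2 ∉ D)) = true then 1 else 0)
      ≤ (if (decide ((a, b).1 ≠ (a, b).2)) = true then 1 else 0) := by
      simp only at ha hb hab
      rcases ha with ha | ha <;> rcases hb with hb | hb
      · simp [retr, ha, hb, hU' a ha, hU' b hb]
      · have hne : a ≠ b := fun h => hU' a ha (h ▸ hb)
        obtain ⟨rfl, rfl⟩ := hedge a ha b hb (hab.resolve_left hne)
        simp [retr, hb, hU' a ha, hD b hb, hne]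
      · have hne : a ≠ b := fun h => hU' b hb (h ▸ ha)
        obtain ⟨rfl, rfl⟩ := hedge b hb a ha (hab.resolve_left hne).symm
        simp [retr, ha, hU' b hb, hD a ha, hne]
      · simp [retr, ha, hb, hD a ha, hD b hb]
    omega


lemma mcc_upper_zero [Fintype V] {G : SimpleGraph V} (hG : G.IsAcyclic) {U D : Set V} {v c : V}
    (hU : ConnFrom G U v) (hD : ConnFrom G D c) (hvc : G.Adj v c) (j : ℕ) :
    mcc G (U ∪ D) v j ≤ mcc G U v j + mcc G D c 0 + 2 := by
  obtain ⟨W, S, h1, h2, h3, h4, h5⟩ := exists_opt_closed hU j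
  obtain ⟨T, t1, t2, t3, t4⟩ := exists_tour hD
  have hm : mcc G D c 0 = wlen T := t4.symm
  have hv' : v ∈ U ∪ D := Or.inl hU.1
  have hTv : Wk G (U ∪ D) c (T ++ [v]) :=
    (t1.mono Set.subset_union_right).append t2 (Wk.single hv') (Or.inr hvc.symm)
  have hWT : Wk G (U ∪ D) v (W ++ (T ++ [v])) :=
    (h1.mono Set.subset_union_left).append h2 hTv (Or.inr hvc)
  have := mcc_le_closed hG (ι := Fin j) S (fun k => (h3 k).mono Set.subset_union_left)
    (W ++ (T ++ [v])) hWT (getLast?_append' (getLast?_append' rfl)) ?_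
  · rw [Fintype.card_fin, wlen_append_ne h2 hTv.2 hvc.ne,
      wlen_append_ne t2 (b := v) rfl hvc.ne.symm, wlen_single] at this
    omega
  · rintro x (hx | hx)
    · rcases h4 x hx with h | h
      · left; simp [h]
      · exact Or.inr h
    · left; simp [t3 x hx]

lemma mcc_upper_pos [Fintype V] {G : SimpleGraph V} (hG : G.IsAcyclic) {U D : Set V} {v c : V}
    (hU : ConnFrom G U v) (hD : ConnFrom G D c) (hvc : G.Adj v c) (j l : ℕ) (hl : 1 ≤ l)
    (hlj : l ≤ j) :
    mcc G (U ∪ D) v j ≤ mcc G U v (j - l) + mcc G D c l + l := by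
  obtain ⟨W, S, h1, h2, h3, h4, h5⟩ := exists_opt_closed hU (j - l)
  obtain ⟨T, t1, t2, t3⟩ := exists_opt hD hl
  have hv' : v ∈ U ∪ D := Or.inl hU.1
  have := mcc_le_closed hG (U := U ∪ D) (v := v) (ι := Fin (j - l) ⊕ Fin l)
    (Sum.elim S (fun k => [v] ++ T k)) ?_ W (h1.mono Set.subset_union_left) h2 ?_
  · have e : ∀ k, wlen ([v] ++ T k) = wlen (T k) + 1 := by
      intro k
      rw [wlen_append_ne (a := v) rfl (t1 k).2 hvc.ne, wlen_single, zero_add]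
    simp only [Fintype.card_sum, Fintype.card_fin, Fintype.sum_sum_type, Sum.elim_inl,
      Sum.elim_inr, e, Finset.sum_add_distrib, Finset.sum_const, Finset.card_univ,
      smul_eq_mul, mul_one, Nat.sub_add_cancel hlj] at this
    omega
  · rintro (k | k)
    · exact (h3 k).mono Set.subset_union_left
    · exact (Wk.single hv').append (a := v) rfl ((t1 k).mono Set.subset_union_right) (Or.inr hvc)
  · rintro x (hx | hx)
    · rcases h4 x hx with h | ⟨k, h⟩
      · exact Or.inl h
      · exact Or.inr ⟨Sum.inl k, h⟩
    · obtain ⟨k, h⟩ := t2 x hx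
      exact Or.inr ⟨Sum.inr k, by simp [h]⟩

lemma connFrom_union {G : SimpleGraph V} {U D : Set V} {v c : V}
    (hU : ConnFrom G U v) (hD : ConnFrom G D c) (hvc : G.Adj v c) : ConnFrom G (U ∪ D) v := by
  refine ⟨Or.inl hU.1, fun A hv hA => ?_⟩
  apply Set.union_subset
  · exact hU.2 A hv (fun x hx y hy => hA x hx y (Or.inl hy))
  · exact hD.2 A (hA v hv c (Or.inr hD.1) hvc) (fun x hx y hy => hA x hx y (Or.inr hy))

lemma mcc_lower [Fintype V] {G : SimpleGraph V} (hG : G.IsAcyclic) {U D : Set V} {v c : V}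
    (hU : ConnFrom G U v) (hD : ConnFrom G D c) (hvc : G.Adj v c) (hdis : Disjoint U D)
    (hedge : ∀ a ∈ U, ∀ b ∈ D, G.Adj a b → a = v ∧ b = c) (j : ℕ) (hj : 1 ≤ j) :
    mcc G U v j + mcc G D c 0 + 2 ≤ mcc G (U ∪ D) v j ∨
    ∃ l, 1 ≤ l ∧ l ≤ j ∧ mcc G U v (j - l) + mcc G D c l + l ≤ mcc G (U ∪ D) v j := by
  classical
  obtain ⟨S, h1, h2, h3⟩ := exists_opt (connFrom_union hU hD hvc) hj
  have hDU : ∀ x ∈ D, x ∉ U := fun x hx hx' => Set.disjoint_left.1 hdis hx' hx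
  have hUD : ∀ x ∈ U, x ∉ D := fun x hx hx' => Set.disjoint_left.1 hdis hx hx'
  have hlast : ∀ k, ∃ z, (S k).getLast? = some z := fun k =>
    ⟨_, List.getLast?_eq_some_getLast (h1 k).1.1.1⟩
  choose z hz using hlast
  have hzm : ∀ k, z k ∈ U ∪ D := fun k => (h1 k).1.2 _ (List.mem_of_getLast? (hz k))
  have hedge' : ∀ a ∈ D, ∀ b ∈ U, G.Adj a b → a = c ∧ b = v :=
    fun a ha b hb h => (hedge b hb a ha h.symm).symm
  have hvD : v ∉ D := hUD v hU.1
  have rv : retr U v v = v := by simp [retr]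
  have rc : retr D c v = c := by simp [retr, hvD]
  have hA := mcc_le_split hG hU.1 (fun k => ¬ z k ∈ D) (fun k => (S k).map (retr U v))
    (fun k => by have := retr_walk hdis hU.1 hedge (h1 k); rwa [rv] at this)
    (fun k hk => by
      have : z k ∉ U := hDU _ (not_not.1 hk)
      simp [hz k, retr, this])
    (fun x hx => by
      obtain ⟨k, hk⟩ := h2 x (Or.inl hx)
      exact ⟨k, List.mem_map.2 ⟨x, hk, by simp [retr, hx]⟩⟩)
  have hB := mcc_le_split hG hD.1 (fun k => z k ∈ D) (fun k => (S k).map (retr D c))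
    (fun k => by
      have := retr_walk hdis.symm hD.1 hedge' (by rw [Set.union_comm]; exact h1 k)
      rwa [rc] at this)
    (fun k hk => by simp [hz k, retr, hk])
    (fun x hx => by
      obtain ⟨k, hk⟩ := h2 x (Or.inr hx)
      exact ⟨k, List.mem_map.2 ⟨x, hk, by simp [retr, hx]⟩⟩)
  have hsum := Finset.sum_le_sum (fun k (_ : k ∈ Finset.univ) =>
    wlen_split (v := v) (c := c) hdis hedge (h1 k))
  simp only [Finset.sum_add_distrib] at hsum
  rw [h3] at hsum
  have henter : ∀ k, ∀ x ∈ S k, x ∈ D →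
      1 ≤ (wsteps (S k)).countP (fun p => decide (p.1 ∈ Dᶜ ∧ p.2 ∉ Dᶜ)) := by
    intro k x hx hxD
    obtain ⟨p, hp, hh⟩ := exit_of_head Dᶜ (h1 k).2 hvD hx (by simpa using hxD)
    exact List.countP_pos_iff.2 ⟨p, hp, by simpa using hh⟩
  have hleave : ∀ k, ∀ x ∈ S k, x ∈ D → z k ∉ D →
      1 ≤ (wsteps (S k)).countP (fun p => decide (p.1 ∈ D ∧ p.2 ∉ D)) := by
    intro k x hx hxD hzk
    obtain ⟨p, hp, hh⟩ := exit_of_last D (hz k) hzk hx hxD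
    exact List.countP_pos_iff.2 ⟨p, hp, by simpa using hh⟩
  have hcard : Fintype.card {k // ¬ z k ∈ D} = j - Fintype.card {k // z k ∈ D} := by
    rw [Fintype.card_subtype_compl, Fintype.card_fin]
  have hcle : Fintype.card {k // z k ∈ D} ≤ j := by
    simpa using Fintype.card_subtype_le (fun k => z k ∈ D)
  rw [hcard] at hA
  rcases Nat.eq_zero_or_pos (Fintype.card {k // z k ∈ D}) with h0 | hpos
  · left
    rw [h0] at hA hB
    rw [Nat.sub_zero] at hA
    obtain ⟨k, hk⟩ := h2 c (Or.inr hD.1)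
    have hzk : z k ∉ D := fun h => (Fintype.card_eq_zero_iff.1 h0).elim ⟨k, h⟩
    have e1 := (henter k c hk hD.1).trans (Finset.single_le_sum
      (f := fun k => (wsteps (S k)).countP (fun p => decide (p.1 ∈ Dᶜ ∧ p.2 ∉ Dᶜ)))
      (fun _ _ => Nat.zero_le _) (Finset.mem_univ k))
    have e2 := (hleave k c hk hD.1 hzk).trans (Finset.single_le_sum
      (f := fun k => (wsteps (S k)).countP (fun p => decide (p.1 ∈ D ∧ p.2 ∉ D)))
      (fun _ _ => Nat.zero_le _) (Finset.mem_univ k))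
    omega
  · right
    refine ⟨_, hpos, hcle, ?_⟩
    have e1 : Fintype.card {k // z k ∈ D} ≤
        ∑ k, (wsteps (S k)).countP (fun p => decide (p.1 ∈ Dᶜ ∧ p.2 ∉ Dᶜ)) := by
      rw [Fintype.card_subtype, Finset.card_filter]
      apply Finset.sum_le_sum
      intro k _
      split_ifs with h
      · exact henter k _ (List.mem_of_getLast? (hz k)) h
      · exact Nat.zero_le _
    omega

lemma delV_adj {G : SimpleGraph V} {v x y : V} :
    (delV G v).Adj x y ↔ G.Adj x y ∧ x ≠ v ∧ y ≠ v := by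
  simp only [delV, SimpleGraph.fromRel_adj]
  constructor
  · rintro ⟨-, h | h⟩
    · exact h
    · exact ⟨h.1.symm, h.2.2, h.2.1⟩
  · exact fun h => ⟨h.1.ne, Or.inl h⟩

lemma not_mem_Dset {G : SimpleGraph V} {v c : V} (hvc : G.Adj v c) : v ∉ Dset G v c := by
  intro h
  obtain ⟨w⟩ := SimpleGraph.Reachable.symm h
  cases w with
  | nil => exact hvc.ne rfl
  | cons h _ => exact (delV_adj.1 h).2.1 rfl

lemma Dset_closed {G : SimpleGraph V} {v c x y : V} (hvc : G.Adj v c) (hx : x ∈ Dset G v c)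
    (hxy : G.Adj x y) (hy : y ≠ v) : y ∈ Dset G v c := by
  have hxv : x ≠ v := fun h => not_mem_Dset hvc (h ▸ hx)
  exact SimpleGraph.Reachable.trans hx (delV_adj.2 ⟨hxy, hxv, hy⟩ : (delV G v).Adj x y).reachable

lemma Dset_adj {G : SimpleGraph V} (hG : G.IsAcyclic) {v c b : V} (hvc : G.Adj v c)
    (hb : b ∈ Dset G v c) (hvb : G.Adj v b) : b = c := by
  by_contra hne
  have hbr := SimpleGraph.isAcyclic_iff_forall_adj_isBridge.1 hG hvc
  rw [SimpleGraph.isBridge_iff] at hbr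
  apply hbr
  have hle : delV G v ≤ G \ SimpleGraph.fromEdgeSet {s(v, c)} := by
    intro x y h
    rw [delV_adj] at h
    simp only [SimpleGraph.sdiff_adj, SimpleGraph.fromEdgeSet_adj, Set.mem_singleton_iff]
    refine ⟨h.1, fun hh => ?_⟩
    rcases Sym2.eq_iff.1 hh.1 with h' | h'
    · exact h.2.1 h'.1
    · exact h.2.2 h'.2
  have h1 : (G \ SimpleGraph.fromEdgeSet {s(v, c)}).Adj v b := by
    simp only [SimpleGraph.sdiff_adj, SimpleGraph.fromEdgeSet_adj, Set.mem_singleton_iff]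
    refine ⟨hvb, fun hh => ?_⟩
    rcases Sym2.eq_iff.1 hh.1 with h' | h'
    · exact hne h'.2
    · exact hvc.ne h'.1
  exact h1.reachable.trans ((SimpleGraph.Reachable.symm hb).mono hle)

lemma connFrom_Dset {G : SimpleGraph V} {v c : V} : ConnFrom G (Dset G v c) c := by
  refine ⟨SimpleGraph.Reachable.refl _, fun A hc hA x hx => ?_⟩
  have hx' := (SimpleGraph.reachable_iff_reflTransGen _ _).1 hx
  induction hx' with
  | refl => exact hc
  | tail h1 h2 ih =>
    have := (SimpleGraph.reachable_iff_reflTransGen _ _).2 h1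
    exact hA _ (ih this) _ hx (delV_adj.1 h2).1

lemma connFrom_Uset {G : SimpleGraph V} {v : V} {m : ℕ} (c : Fin m → V)
    (hadj : ∀ i, G.Adj v (c i)) (n : ℕ) : ConnFrom G (Uset G v c n) v := by
  refine ⟨Set.mem_insert _ _, fun A hv hA x hx => ?_⟩
  rcases hx with rfl | hx
  · exact hv
  · simp only [Set.mem_iUnion] at hx
    obtain ⟨l, hl, hx⟩ := hx
    have hsub : Dset G v (c l) ⊆ Uset G v c n := fun y hy =>
      Or.inr (by simp only [Set.mem_iUnion]; exact ⟨l, hl, hy⟩)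
    have hcl := (connFrom_Dset (G := G) (v := v) (c := c l))
    exact hcl.2 A (hA v hv _ (hsub hcl.1) (hadj l)) (fun x hx y hy => hA x hx y (hsub hy)) hx

end Helpers

/-- Dynamic-programming recurrence for covering T_v[i+1] with j robots at v:
C[v,i+1,j] = min( C[v,i,j] + C[vᵢ,deg vᵢ,0] + 2 ,
                  min_{1 ≤ l ≤ j} C[v,i,j-l] + C[vᵢ,deg vᵢ,l] + l ). -/
theorem stmt18 {V : Type*} [Fintype V] [DecidableEq V] (G : SimpleGraph V) (hT : G.IsTree)
    (v : V) {m : ℕ} (c : Fin m → V) (hcinj : Function.Injective c)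
    (hadj : ∀ i, G.Adj v (c i))
    (i : Fin m) (j : ℕ) (hj : 1 ≤ j) :
    mcc G (Uset G v c ((i : ℕ) + 1)) v j =
      min (mcc G (Uset G v c (i : ℕ)) v j + mcc G (Dset G v (c i)) (c i) 0 + 2)
        (sInf {x : ℕ | ∃ l, 1 ≤ l ∧ l ≤ j ∧
          x = mcc G (Uset G v c (i : ℕ)) v (j - l) +
              mcc G (Dset G v (c i)) (c i) l + l}) := by
  have hG := hT.isAcyclic
  have hU := connFrom_Uset c hadj (i : ℕ)
  have hD := connFrom_Dset (G := G) (v := v) (c := c i)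
  have hvc := hadj i
  have hmem : ∀ x ∈ Uset G v c (i : ℕ), x ∈ Dset G v (c i) → False := by
    intro x hx hxD
    rcases hx with rfl | hx
    · exact not_mem_Dset hvc hxD
    · simp only [Set.mem_iUnion] at hx
      obtain ⟨l, hl, hx⟩ := hx
      have h1 : c l ∈ Dset G v (c i) := SimpleGraph.Reachable.trans hxD (SimpleGraph.Reachable.symm hx)
      have h2 := hcinj (Dset_adj hG hvc h1 (hadj l))
      rw [h2] at hl
      exact lt_irrefl _ hl
  have hdis : Disjoint (Uset G v c (i : ℕ)) (Dset G v (c i)) := Set.disjoint_left.2 hmem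
  have hedge : ∀ a ∈ Uset G v c (i : ℕ), ∀ b ∈ Dset G v (c i), G.Adj a b → a = v ∧ b = c i := by
    intro a ha b hb hab
    have hav : a = v := by
      by_contra hne
      exact hmem a ha (Dset_closed hvc hb hab.symm hne)
    subst hav
    exact ⟨rfl, Dset_adj hG hvc hb hab⟩
  have hun : Uset G v c ((i : ℕ) + 1) = Uset G v c (i : ℕ) ∪ Dset G v (c i) := by
    ext x
    simp only [Uset, Set.mem_union, Set.mem_insert_iff, Set.mem_iUnion]
    constructor
    · rintro (h | ⟨l, hl, hx⟩)
      · exact Or.inl (Or.inl h)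
      · rcases Nat.lt_succ_iff_lt_or_eq.1 hl with h | h
        · exact Or.inl (Or.inr ⟨l, h, hx⟩)
        · rw [Fin.ext h] at hx
          exact Or.inr hx
    · rintro ((h | ⟨l, hl, hx⟩) | h)
      · exact Or.inl h
      · exact Or.inr ⟨l, by omega, hx⟩
      · exact Or.inr ⟨i, by omega, h⟩
  rw [hun]
  apply le_antisymm
  · apply le_min
    · exact mcc_upper_zero hG hU hD hvc j
    · apply le_csInf
      · exact ⟨_, 1, le_refl _, hj, rfl⟩
      · rintro x ⟨l, hl, hlj, rfl⟩
        exact mcc_upper_pos hG hU hD hvc j l hl hlj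
  · rcases mcc_lower hG hU hD hvc hdis hedge j hj with h | ⟨l, hl, hlj, h⟩
    · exact (min_le_left _ _).trans h
    · refine (min_le_right _ _).trans (le_trans (Nat.sInf_le ?_) h)
      exact ⟨l, hl, hlj, rfl⟩
end
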